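/- Let p > 3 be a prime, q = p^r with q ≡ 1 (mod 3), and let a ∈ F_q^× with a³ ≠ 1. Then Σ_{x,y,z ∈ F_q^×} ψ(z(1 + x³ + y³ − 3axy)) = (q²·φ(−3a)/(q−1)) Σ_{l=0, l≠(q−1)/2}^{q−2} [G_{−2l}³ G_{6l} / (G_{−l}³ G_{3l})] · T^{−3l}(−3a) + 1/(q−1) − 6q·φ(−3), as an identity of complex numbers (all Gauss sums G_k are nonzero in ℂ, so the quotients are well defined; indices of G and exponents of T are taken modulo q−1). -/

import Mathlib

section

open Finset

lemma Complex.eq_of_sum_eq_card_mul {ι : Type*} {s : Finset ι} {f : ι → ℂ} {R : ℝ}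
    (hf : ∀ i ∈ s, ‖f i‖ = R) (h : ∑ i ∈ s, f i = #s * R) : ∀ i ∈ s, f i = R := by
  have h0 : ∑ i ∈ s, (R - (f i).re) = 0 := by
    rw [Finset.sum_sub_distrib, ← Complex.re_sum, h]
    simp
  have hnn : ∀ i ∈ s, 0 ≤ R - (f i).re := fun i hi ↦ by
    rw [sub_nonneg, ← hf i hi]
    exact Complex.re_le_norm _
  intro i hi
  have hi0 := (Finset.sum_eq_zero_iff_of_nonneg hnn).mp h0 i hi
  have hre : (f i).re = ‖f i‖ := by rw [hf i hi]; linarith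
  have h2 := Complex.eq_coe_norm_of_nonneg (Complex.re_eq_norm.mp hre)
  rw [h2, hf i hi]

lemma exists_zpow_of_pow_eq_one {G : Type*} [Group G] {T χ : G}
    (hT : ∀ χ : G, χ ∈ Subgroup.zpowers T) {m d : ℕ} (hd : d ≠ 0) (hn : orderOf T = m * d)
    (hχ : χ ^ d = 1) : ∃ j : ℤ, χ = (T ^ m) ^ j := by
  obtain ⟨k, rfl⟩ := Subgroup.mem_zpowers_iff.mp (hT χ)
  rw [← zpow_natCast, ← zpow_mul, ← orderOf_dvd_iff_zpow_eq_one, hn, Nat.cast_mul] at hχ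
  obtain ⟨j, rfl⟩ := (mul_dvd_mul_iff_right (by exact_mod_cast hd)).mp hχ
  exact ⟨j, by rw [zpow_mul, zpow_natCast]⟩

lemma eq_one_or_eq_of_sq_eq_one {G : Type*} [Group G] {T χ : G}
    (hT : ∀ χ : G, χ ∈ Subgroup.zpowers T) {m : ℕ} (hn : orderOf T = m * 2) (hχ : χ ^ 2 = 1) :
    χ = 1 ∨ χ = T ^ m := by
  obtain ⟨j, rfl⟩ := exists_zpow_of_pow_eq_one hT two_ne_zero hn hχ
  have h2 : (T ^ m) ^ (2 : ℤ) = 1 := by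
    rw [← zpow_natCast T, ← zpow_mul]
    exact_mod_cast hn ▸ pow_orderOf_eq_one T
  rcases Int.even_or_odd' j with ⟨k, rfl | rfl⟩
  · left; rw [zpow_mul, h2, one_zpow]
  · right; rw [zpow_add, zpow_mul, h2, one_zpow, one_mul, zpow_one]

lemma eq_one_or_eq_or_eq_inv_of_cube_eq_one {G : Type*} [Group G] {T χ : G}
    (hT : ∀ χ : G, χ ∈ Subgroup.zpowers T) {m : ℕ} (hn : orderOf T = m * 3) (hχ : χ ^ 3 = 1) :
    χ = 1 ∨ χ = T ^ m ∨ χ = (T ^ m)⁻¹ := by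
  obtain ⟨j, rfl⟩ := exists_zpow_of_pow_eq_one hT three_ne_zero hn hχ
  have h3 : (T ^ m) ^ (3 : ℤ) = 1 := by
    rw [← zpow_natCast T, ← zpow_mul]
    exact_mod_cast hn ▸ pow_orderOf_eq_one T
  have hj : j = 3 * (j / 3) ∨ j = 3 * (j / 3) + 1 ∨ j = 3 * (j / 3 + 1) + -1 := by omega
  rcases hj with h | h | h <;> rw [h]
  · left; rw [zpow_mul, h3, one_zpow]
  · right; left; rw [zpow_add, zpow_mul, h3, one_zpow, one_mul, zpow_one]
  · right; right; rw [zpow_add, zpow_mul, h3, one_zpow, one_mul, zpow_neg_one]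

lemma sum_range_eq_sum_ne {G : Type*} [Group G] [Fintype G] [DecidableEq G] {T : G}
    (hT : ∀ χ : G, χ ∈ Subgroup.zpowers T) {m : ℕ} (hm : m < orderOf T) (f : G → ℂ) :
    ∑ l ∈ (range (orderOf T)).filter (fun l ↦ l ≠ m), f (T ^ l) = ∑ χ with χ ≠ T ^ m, f χ := by
  refine Finset.sum_nbij (fun l ↦ T ^ l) ?_ ?_ ?_ fun l _ ↦ rfl
  · intro l hl
    simp only [mem_filter, mem_range, mem_univ, true_and] at hl ⊢
    exact fun h ↦ hl.2 (pow_injOn_Iio_orderOf hl.1 hm h)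
  · intro l hl k hk h
    simp only [coe_filter, mem_range, Set.mem_ofPred_eq] at hl hk
    exact pow_injOn_Iio_orderOf hl.1 hk.1 h
  · intro χ hχ
    have : χ ∈ (range (orderOf T)).image (T ^ ·) := by
      rw [IsCyclic.image_range_orderOf hT]
      exact mem_univ χ
    obtain ⟨l, hl, rfl⟩ := mem_image.mp this
    simp only [coe_filter, mem_univ, true_and, Set.mem_ofPred_eq] at hχ
    refine ⟨l, ?_, rfl⟩
    simp only [coe_filter, Set.mem_ofPred_eq]
    exact ⟨hl, fun h ↦ hχ (h ▸ rfl)⟩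

lemma exists_primitive_cube_root {F : Type*} [Field F] [Fintype F] (h : Fintype.card F % 3 = 1) :
    ∃ ζ : F, ζ ^ 2 + ζ + 1 = 0 := by
  classical
  obtain ⟨ζ, hζ⟩ := exists_prime_orderOf_dvd_card (G := Fˣ) 3 (by
    rw [Fintype.card_units]; omega)
  refine ⟨ζ, ?_⟩
  have h1 : (ζ : F) - 1 ≠ 0 := by
    rw [sub_ne_zero]
    intro h
    rw [Units.val_eq_one] at h
    simp [h] at hζ
  have h3 : (ζ : F) ^ 3 = 1 := by
    rw [← Units.val_pow_eq_pow_val, ← hζ, pow_orderOf_eq_one, Units.val_one]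
  refine (mul_eq_zero.mp (?_ : ((ζ : F) - 1) * _ = 0)).resolve_left h1
  linear_combination h3

lemma natCast_ne_zero_of_coprime_card {F : Type*} [Field F] [Fintype F] {n : ℕ}
    (h : n.Coprime (Fintype.card F)) : (n : F) ≠ 0 := by
  intro h0
  have h1 := Nat.isCoprime_iff_coprime.mpr h
  obtain ⟨u, v, huv⟩ := h1
  have := congrArg (Int.cast : ℤ → F) huv
  simp [h0] at this

variable {F : Type*} [Field F]

lemma filter_sq_eq_one [Fintype (MulChar F ℂ)] [DecidableEq (MulChar F ℂ)] {φ : MulChar F ℂ}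
    (hφ2 : φ ^ 2 = 1) (hφ : ∀ χ : MulChar F ℂ, χ ^ 2 = 1 → χ = 1 ∨ χ = φ) :
    ({χ : MulChar F ℂ | χ ^ 2 = 1} : Finset _) = {1, φ} := by
  ext χ
  simp only [mem_filter, mem_univ, true_and, mem_insert, mem_singleton]
  exact ⟨hφ χ, by rintro (rfl | rfl) <;> simp [hφ2]⟩

/-- The nodal cubic `U²V + UV² + 1 = 3UV` is parametrised by `ρ = (U - 1) / (V - 1)`. -/
lemma nodal_cubic_param {U V ρ : F} (hV1 : V - 1 ≠ 0)
    (h : U ^ 2 * V + U * V ^ 2 + 1 = 3 * (U * V)) (hρ : ρ = (U - 1) / (V - 1)) :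
    ρ * (1 + ρ) * V = -1 ∧ U = ρ ^ 3 * V := by
  subst hρ
  constructor
  · field_simp
    linear_combination h
  · field_simp
    linear_combination (V - U) * h

lemma cubic_eq_of_add_inv {U V : Fˣ} (h : (U : F) + V + (U * V : Fˣ)⁻¹ + -3 = 0) :
    (U : F) ^ 2 * V + U * V ^ 2 + 1 = 3 * (U * V) := by
  have := U.ne_zero
  have := V.ne_zero
  simp only [Units.val_inv_eq_inv_val, Units.val_mul] at h
  field_simp at h
  linear_combination h

lemma filter_cube_eq_one [Fintype (MulChar F ℂ)] [DecidableEq (MulChar F ℂ)] {ω : MulChar F ℂ}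
    (hω3 : ω ^ 3 = 1) (hω : ∀ χ : MulChar F ℂ, χ ^ 3 = 1 → χ = 1 ∨ χ = ω ∨ χ = ω⁻¹) :
    ({χ : MulChar F ℂ | χ ^ 3 = 1} : Finset _) = {1, ω, ω⁻¹} := by
  ext χ
  simp only [mem_filter, mem_univ, true_and, mem_insert, mem_singleton]
  exact ⟨hω χ, by rintro (rfl | rfl | rfl) <;> simp [hω3]⟩

lemma ne_inv_of_cube_eq_one {ω : MulChar F ℂ} (hω1 : ω ≠ 1) (hω3 : ω ^ 3 = 1) : ω ≠ ω⁻¹ := by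
  intro h
  apply hω1
  rw [eq_inv_iff_mul_eq_one] at h
  rwa [pow_succ, sq, h, one_mul] at hω3

lemma card_filter_cube_eq_one [Fintype (MulChar F ℂ)] [DecidableEq (MulChar F ℂ)]
    {ω : MulChar F ℂ} (hω1 : ω ≠ 1) (hω3 : ω ^ 3 = 1)
    (hω : ∀ χ : MulChar F ℂ, χ ^ 3 = 1 → χ = 1 ∨ χ = ω ∨ χ = ω⁻¹) :
    #{χ : MulChar F ℂ | χ ^ 3 = 1} = 3 := by
  rw [filter_cube_eq_one hω3 hω, card_eq_three]
  exact ⟨1, ω, ω⁻¹, hω1.symm, by simpa [eq_comm] using hω1, ne_inv_of_cube_eq_one hω1 hω3, rfl⟩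

variable [Fintype F]

lemma norm_gaussSum_sq {χ : MulChar F ℂ} (hχ : χ ≠ 1) {ψ : AddChar F ℂ} (hψ : ψ ≠ 1) :
    ‖gaussSum χ ψ‖ ^ 2 = Fintype.card F := by
  have h := gaussSum_mul_gaussSum_eq_card hχ (AddChar.IsPrimitive.of_ne_one hψ)
  rw [← star_gaussSum_eq, ← starRingEnd_apply, Complex.mul_conj'] at h
  exact_mod_cast h

lemma gaussSum_ne_zero (χ : MulChar F ℂ) {ψ : AddChar F ℂ} (hψ : ψ ≠ 1) : gaussSum χ ψ ≠ 0 := by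
  by_cases hχ : χ = 1
  · simp [hχ, gaussSum_one_left hψ]
  · exact gaussSum_ne_zero_of_nontrivial (by simp) hχ (AddChar.IsPrimitive.of_ne_one hψ)

lemma cubic_gaussSum_prod_of_pow_eq_one {ψ : AddChar F ℂ} (hψ : ψ ≠ 1) {ω χ : MulChar F ℂ}
    (hω1 : ω ≠ 1) (hω3 : ω ^ 3 = 1)
    (hω : ∀ χ : MulChar F ℂ, χ ^ 3 = 1 → χ = 1 ∨ χ = ω ∨ χ = ω⁻¹) (hχ : χ ^ 3 = 1) (c : Fˣ) :
    gaussSum (χ⁻¹ * ω) ψ * gaussSum (χ⁻¹ * ω⁻¹) ψ * gaussSum χ⁻¹ ψ * gaussSum (χ ^ 3) ψ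
        * (χ ^ 3)⁻¹ c = Fintype.card F := by
  have hneg : ω⁻¹ (-1) = 1 := by
    rw [MulChar.inv_apply', inv_neg_one, show (-1 : F) = ((-1 : Fˣ) : F) ^ 3 by norm_num, map_pow,
      ← MulChar.pow_apply_coe, hω3, MulChar.one_apply_coe]
  have key : gaussSum ω ψ * gaussSum ω⁻¹ ψ = Fintype.card F := by
    rw [← mul_gaussSum_inv_eq_gaussSum ω⁻¹, hneg, one_mul,
      gaussSum_mul_gaussSum_eq_card hω1 (AddChar.IsPrimitive.of_ne_one hψ)]
  have e1 : ω⁻¹ * ω⁻¹ = ω := by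
    rw [← mul_inv, inv_eq_iff_mul_eq_one, ← hω3, pow_three']
  have e2 : ω * ω = ω⁻¹ := by rw [eq_inv_iff_mul_eq_one, ← hω3, pow_three']
  rw [hχ, inv_one, MulChar.one_apply_coe, mul_one, gaussSum_one_left hψ]
  rcases hω χ hχ with rfl | rfl | rfl
  · rw [inv_one, one_mul, one_mul, gaussSum_one_left hψ, key]; ring
  · rw [inv_mul_cancel, e1, gaussSum_one_left hψ, ← key]; ring
  · rw [inv_inv, e2, mul_inv_cancel, gaussSum_one_left hψ, ← key]; ring

lemma quadratic_gaussSum_pow_four {ψ : AddChar F ℂ} (hψ : ψ ≠ 1) {φ : MulChar F ℂ} (hφ1 : φ ≠ 1)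
    (hφ2 : φ ^ 2 = 1) : gaussSum φ ψ ^ 4 = (Fintype.card F : ℂ) ^ 2 := by
  have h := gaussSum_sq hφ1 (MulChar.isQuadratic_iff_sq_eq_one.mpr hφ2)
    (AddChar.IsPrimitive.of_ne_one hψ)
  have h1 : φ (-1) ^ 2 = 1 := by
    rw [← map_pow, neg_one_sq, map_one]
  calc
    _ = (gaussSum φ ψ ^ 2) ^ 2 := by ring
    _ = _ := by rw [h, mul_pow, h1, one_mul]

variable [DecidableEq F]

lemma sum_mulChar_apply_unit [Fintype (MulChar F ℂ)] (u : Fˣ) :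
    ∑ χ : MulChar F ℂ, χ (u : F) = if u = 1 then (Fintype.card F : ℂ) - 1 else 0 := by
  split_ifs with hu
  · have h := MulChar.card_eq_card_units_of_hasEnoughRootsOfUnity F ℂ
    rw [Nat.card_eq_fintype_card, Nat.card_eq_fintype_card, Fintype.card_units] at h
    simp [hu, h, Nat.cast_sub Fintype.card_pos]
  · obtain ⟨χ, hχ⟩ := MulChar.exists_apply_ne_one_of_hasEnoughRootsOfUnity F ℂ
      (a := (u : F)) (by simpa using hu)
    refine eq_zero_of_mul_eq_self_left hχ ?_
    simp only [Finset.mul_sum, ← MulChar.mul_apply]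
    exact Fintype.sum_bijective _ (Group.mulLeft_bijective χ) _ _ fun χ' ↦ rfl

lemma sum_eq_zero_add_sum_units (f : F → ℂ) : ∑ x, f x = f 0 + ∑ u : Fˣ, f u := by
  rw [← Finset.add_sum_erase _ _ (mem_univ (0 : F))]
  congr 1
  refine (Finset.sum_bij' (fun (u : Fˣ) _ ↦ (u : F)) (fun x hx ↦ Units.mk0 x (ne_of_mem_erase hx))
    ?_ ?_ ?_ ?_ ?_).symm <;> simp

lemma gaussSum_eq_sum_units (χ : MulChar F ℂ) (ψ : AddChar F ℂ) :
    gaussSum χ ψ = ∑ u : Fˣ, χ u * ψ u := by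
  rw [gaussSum, sum_eq_zero_add_sum_units]
  simp [MulChar.map_zero]

lemma sum_units_mulChar_eq_zero {χ : MulChar F ℂ} (hχ : χ ≠ 1) : ∑ u : Fˣ, χ u = 0 := by
  simpa [sum_eq_zero_add_sum_units, MulChar.map_zero] using χ.sum_eq_zero_of_ne_one hχ

lemma sum_units_addChar_mul {ψ : AddChar F ℂ} (hψ : ψ ≠ 1) (t : F) :
    ∑ z : Fˣ, ψ (z * t) = (Fintype.card F : ℂ) * (if t = 0 then 1 else 0) - 1 := by
  have h := AddChar.sum_mulShift t (AddChar.IsPrimitive.of_ne_one hψ)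
  rw [sum_eq_zero_add_sum_units] at h
  simp only [zero_mul, AddChar.map_zero_eq_one] at h
  rw [← eq_sub_iff_add_eq'] at h
  rw [h]
  split_ifs <;> simp

/-- The number of `n`-th roots of `u` is the sum of the values at `u` of the characters
killed by `n`. -/
lemma card_units_pow_eq [Fintype (MulChar F ℂ)] [DecidableEq (MulChar F ℂ)] (n : ℕ) (u : Fˣ) :
    (#{x : Fˣ | x ^ n = u} : ℂ) = ∑ χ : MulChar F ℂ with χ ^ n = 1, χ u := by
  have hq : (Fintype.card F : ℂ) - 1 ≠ 0 := by
    rw [sub_ne_zero]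
    exact_mod_cast Fintype.one_lt_card.ne'
  refine mul_left_cancel₀ hq ?_
  have h1 : ∑ x : Fˣ, ∑ χ : MulChar F ℂ, χ ((u * (x ^ n)⁻¹ : Fˣ) : F)
      = ((Fintype.card F : ℂ) - 1) * (#{x : Fˣ | x ^ n = u} : ℂ) := by
    simp_rw [sum_mulChar_apply_unit, mul_inv_eq_one, eq_comm (a := u)]
    rw [← Finset.sum_filter, Finset.sum_const, nsmul_eq_mul, mul_comm]
  rw [← h1, Finset.sum_comm, Finset.sum_filter, Finset.mul_sum]
  refine Finset.sum_congr rfl fun χ _ ↦ ?_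
  have h2 (x : Fˣ) : χ ((u * (x ^ n)⁻¹ : Fˣ) : F) = χ u * (χ ^ n)⁻¹ x := by
    rw [MulChar.inv_apply', ← Units.val_inv_eq_inv_val, MulChar.pow_apply_coe, ← map_pow,
      ← map_mul]
    simp
  simp_rw [h2, ← Finset.mul_sum]
  split_ifs with h
  · simp [h, MulChar.one_apply_coe, Fintype.card_units, Nat.cast_sub Fintype.card_pos, mul_comm]
  · rw [sum_units_mulChar_eq_zero (by simpa using h)]
    simp

lemma sum_units_pow [Fintype (MulChar F ℂ)] [DecidableEq (MulChar F ℂ)] (n : ℕ) (f : Fˣ → ℂ) :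
    ∑ x : Fˣ, f (x ^ n) = ∑ u : Fˣ, (∑ χ : MulChar F ℂ with χ ^ n = 1, χ u) * f u := by
  rw [← Finset.sum_fiberwise' univ (fun x : Fˣ ↦ x ^ n) f]
  simp [← card_units_pow_eq]

lemma four_mul_jacobiSum_self {χ φ : MulChar F ℂ} (h2 : (2 : F) ≠ 0) (hχ : χ ≠ 1) (hφ1 : φ ≠ 1)
    (hφ2 : φ ^ 2 = 1) (hφ : ∀ χ : MulChar F ℂ, χ ^ 2 = 1 → χ = 1 ∨ χ = φ) :
    χ 4 * jacobiSum χ χ = jacobiSum χ φ := by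
  classical
  have := Fintype.ofFinite (MulChar F ℂ)
  have h1 : χ 4 * jacobiSum χ χ = ∑ y : F, χ (1 - y ^ 2) := by
    rw [jacobiSum, Finset.mul_sum]
    refine Fintype.sum_equiv ((Equiv.mulLeft₀ (2 : F) h2).trans (Equiv.subLeft 1)) _ _ fun x ↦ ?_
    rw [← map_mul, ← map_mul]
    congr 1
    simp
    ring
  have h5 := sum_eq_zero_add_sum_units (fun x ↦ φ x * χ (1 - x))
  rw [h1, sum_eq_zero_add_sum_units, jacobiSum_comm, jacobiSum, h5]
  have h3 := sum_units_pow (F := F) 2 (fun y ↦ χ (1 - y))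
  simp only [Units.val_pow_eq_pow_val] at h3
  rw [h3, filter_sq_eq_one hφ2 hφ]
  simp_rw [Finset.sum_pair hφ1.symm, MulChar.one_apply_coe, add_mul, Finset.sum_add_distrib]
  have h4 : ∑ x : F, χ (1 - x) = 0 := by
    rw [← χ.sum_eq_zero_of_ne_one hχ]
    exact Fintype.sum_equiv (Equiv.subLeft 1) _ _ fun x ↦ rfl
  rw [sum_eq_zero_add_sum_units] at h4
  simp only [sub_zero, map_one, one_mul] at h4 ⊢
  simp only [ne_eq, OfNat.ofNat_ne_zero, not_false_eq_true, zero_pow, sub_zero, map_one,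
    MulChar.map_zero, zero_mul, zero_add]
  linear_combination h4

/-- The quadratic Hasse–Davenport product formula. -/
lemma gaussSum_mul_gaussSum_quadratic {ψ : AddChar F ℂ} (hψ : ψ ≠ 1) (χ : MulChar F ℂ)
    {φ : MulChar F ℂ} (h2 : (2 : F) ≠ 0) (hφ1 : φ ≠ 1)
    (hφ2 : φ ^ 2 = 1) (hφ : ∀ χ : MulChar F ℂ, χ ^ 2 = 1 → χ = 1 ∨ χ = φ) :
    χ 4 * (gaussSum χ ψ * gaussSum (χ * φ) ψ) = gaussSum (χ ^ 2) ψ * gaussSum φ ψ := by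
  have h4 : (4 : F) ≠ 0 := by
    have : (4 : F) = 2 * 2 := by norm_num
    simp [this, h2]
  by_cases hχ : χ ^ 2 = 1
  · have h5 : χ 4 = 1 := by
      have : (4 : F) = ((Units.mk0 2 h2 : Fˣ) : F) ^ 2 := by simp; norm_num
      rw [this, map_pow, ← MulChar.pow_apply_coe, hχ, MulChar.one_apply_coe]
    rw [h5]
    rcases hφ χ hχ with rfl | rfl
    · simp
    · rw [← sq, hφ2]; ring
  · have hχ1 : χ ≠ 1 := by rintro rfl; simp at hχ
    have hχφ : χ * φ ≠ 1 := by
      intro h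
      apply hχ
      have : χ = φ⁻¹ := eq_inv_of_mul_eq_one_left h
      rw [this, inv_pow, hφ2, inv_one]
    have e1 := jacobiSum_mul_nontrivial (χ := χ) (φ := χ) (by rwa [← sq]) ψ
    have e2 := jacobiSum_mul_nontrivial hχφ ψ
    rw [← four_mul_jacobiSum_self h2 hχ1 hφ1 hφ2 hφ] at e2
    rw [← sq χ] at e1
    refine mul_left_cancel₀ (gaussSum_ne_zero χ hψ) ?_
    linear_combination (-χ 4 * gaussSum (χ * φ) ψ) * e1 + gaussSum (χ ^ 2) ψ * e2

lemma gaussSum_eq_sum_units_mul (χ : MulChar F ℂ) (ψ : AddChar F ℂ) (z : Fˣ) :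
    gaussSum χ ψ = χ z * ∑ u : Fˣ, χ u * ψ (z * u) := by
  rw [← gaussSum_mulShift χ ψ z, gaussSum_eq_sum_units]
  simp [AddChar.mulShift_apply]

lemma gaussSum_prod_eq_sum (ψ : AddChar F ℂ) (α χ : MulChar F ℂ) (c : Fˣ) :
    gaussSum (χ⁻¹ * α) ψ * gaussSum (χ⁻¹ * α⁻¹) ψ * gaussSum χ⁻¹ ψ * gaussSum (χ ^ 3) ψ
        * (χ ^ 3)⁻¹ c
      = ∑ z : Fˣ, ∑ U : Fˣ, ∑ V : Fˣ, ∑ W : Fˣ,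
          χ ((U * V * W : Fˣ)⁻¹ : Fˣ) * (α (U * V⁻¹ : Fˣ) * ψ (z * (U + V + W + c))) := by
  have h1 : (χ ^ 3)⁻¹ c * gaussSum (χ ^ 3) ψ = ∑ z : Fˣ, (χ ^ 3) z * ψ (z * c) := by
    rw [← gaussSum_mulShift_eq, gaussSum_eq_sum_units]
    simp [AddChar.mulShift_apply, mul_comm]
  rw [mul_assoc, mul_comm (gaussSum (χ ^ 3) ψ), h1, Finset.mul_sum]
  refine Finset.sum_congr rfl fun z _ ↦ ?_
  rw [gaussSum_eq_sum_units_mul (χ⁻¹ * α) ψ z, gaussSum_eq_sum_units_mul (χ⁻¹ * α⁻¹) ψ z,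
    gaussSum_eq_sum_units_mul χ⁻¹ ψ z]
  have hz : (χ⁻¹ * α) z * (χ⁻¹ * α⁻¹) z * χ⁻¹ z * (χ ^ 3) z = 1 := by
    rw [← MulChar.mul_apply, ← MulChar.mul_apply, ← MulChar.mul_apply,
      show χ⁻¹ * α * (χ⁻¹ * α⁻¹) * χ⁻¹ * χ ^ 3 = 1 by
        rw [mul_mul_mul_comm, mul_inv_cancel, mul_one]; group, MulChar.one_apply_coe]
  calc
    _ = ((χ⁻¹ * α) z * (χ⁻¹ * α⁻¹) z * χ⁻¹ z * (χ ^ 3) z) *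
        ((∑ u : Fˣ, (χ⁻¹ * α) u * ψ (z * u)) * ((∑ u : Fˣ, (χ⁻¹ * α⁻¹) u * ψ (z * u)) *
          ((∑ u : Fˣ, χ⁻¹ u * ψ (z * u)) * ψ (z * c)))) := by ring
    _ = _ := by
      rw [hz, one_mul, Finset.sum_mul]
      refine Finset.sum_congr rfl fun U _ ↦ ?_
      rw [Finset.sum_mul, Finset.mul_sum]
      refine Finset.sum_congr rfl fun V _ ↦ ?_
      rw [Finset.sum_mul, Finset.mul_sum, Finset.mul_sum]
      refine Finset.sum_congr rfl fun W _ ↦ ?_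
      have e1 : χ ((U * V * W : Fˣ)⁻¹ : Fˣ) = χ⁻¹ U * χ⁻¹ V * χ⁻¹ W := by
        simp only [MulChar.inv_apply', ← map_mul]
        congr 1
        simp [mul_assoc, mul_comm, mul_left_comm]
      have e2 : α (U * V⁻¹ : Fˣ) = α U * α⁻¹ V := by
        simp only [MulChar.inv_apply', ← map_mul]
        simp
      rw [e1, e2, MulChar.mul_apply, MulChar.mul_apply, mul_add, mul_add, mul_add,
        AddChar.map_add_eq_mul, AddChar.map_add_eq_mul, AddChar.map_add_eq_mul]
      ring

lemma sum_gaussSum_prod_eq [Fintype (MulChar F ℂ)] (ψ : AddChar F ℂ) (α : MulChar F ℂ) (c : Fˣ) :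
    ∑ χ : MulChar F ℂ, gaussSum (χ⁻¹ * α) ψ * gaussSum (χ⁻¹ * α⁻¹) ψ * gaussSum χ⁻¹ ψ *
        gaussSum (χ ^ 3) ψ * (χ ^ 3)⁻¹ c
      = ((Fintype.card F : ℂ) - 1) * ∑ U : Fˣ, ∑ V : Fˣ, α (U * V⁻¹ : Fˣ) *
          ∑ z : Fˣ, ψ (z * (U + V + (U * V : Fˣ)⁻¹ + c)) := by
  simp_rw [gaussSum_prod_eq_sum, Finset.mul_sum]
  rw [Finset.sum_comm]
  have h (z : Fˣ) : ∑ χ : MulChar F ℂ, ∑ U : Fˣ, ∑ V : Fˣ, ∑ W : Fˣ,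
          χ ((U * V * W : Fˣ)⁻¹ : Fˣ) * (α (U * V⁻¹ : Fˣ) * ψ (z * (U + V + W + c)))
      = ∑ U : Fˣ, ∑ V : Fˣ, ((Fintype.card F : ℂ) - 1) *
          (α (U * V⁻¹ : Fˣ) * ψ (z * (U + V + (U * V : Fˣ)⁻¹ + c))) := by
    rw [Finset.sum_comm]
    refine Finset.sum_congr rfl fun U _ ↦ ?_
    rw [Finset.sum_comm]
    refine Finset.sum_congr rfl fun V _ ↦ ?_
    rw [Finset.sum_comm]
    simp_rw [← Finset.sum_mul, sum_mulChar_apply_unit, inv_eq_one, mul_eq_one_iff_inv_eq]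
    simp
  simp_rw [h]
  rw [Finset.sum_comm]
  refine Finset.sum_congr rfl fun U _ ↦ ?_
  rw [Finset.sum_comm]

lemma sum_hessian_eq [Fintype (MulChar F ℂ)] [DecidableEq (MulChar F ℂ)] (ψ : AddChar F ℂ)
    (d : F) :
    ∑ x : Fˣ, ∑ y : Fˣ, ∑ z : Fˣ, ψ (z * (1 + (x : F) ^ 3 + (y : F) ^ 3 + d * x * y))
      = ∑ χ : MulChar F ℂ with χ ^ 3 = 1, ∑ U : Fˣ, ∑ V : Fˣ, χ (U * V⁻¹ : Fˣ) *
          ∑ z : Fˣ, ψ (z * (U + V + (U * V : Fˣ)⁻¹ + d)) := by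
  have h1 (x y : Fˣ) : ∑ z : Fˣ, ψ (z * (1 + (x : F) ^ 3 + (y : F) ^ 3 + d * x * y))
      = ∑ z : Fˣ, ψ (z * (((x ^ 2 * y⁻¹ : Fˣ) : F) + (y ^ 2 * x⁻¹ : Fˣ) +
          ((x * y : Fˣ)⁻¹ : Fˣ) + d)) := by
    refine Fintype.sum_equiv (Equiv.mulRight (x * y)) _ _ fun z ↦ ?_
    congr 1
    have := x.ne_zero
    have := y.ne_zero
    simp
    field_simp
    ring
  simp_rw [h1]
  set f : Fˣ → Fˣ → ℂ := fun U V ↦ ∑ z : Fˣ, ψ (z * (U + V + (U * V : Fˣ)⁻¹ + d)) with hf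
  have h2 (x y : Fˣ) : ∑ z : Fˣ, ψ (z * (((x ^ 2 * y⁻¹ : Fˣ) : F) + (y ^ 2 * x⁻¹ : Fˣ) +
          ((x * y : Fˣ)⁻¹ : Fˣ) + d)) = f (y ^ 2 * x⁻¹) (x ^ 2 * y⁻¹) := by
    have : x * y = y ^ 2 * x⁻¹ * (x ^ 2 * y⁻¹) := by
      ext
      simp
      field_simp
    rw [hf, this, add_comm ((x ^ 2 * y⁻¹ : Fˣ) : F)]
  simp_rw [h2]
  have h3 (x : Fˣ) : ∑ y : Fˣ, f (y ^ 2 * x⁻¹) (x ^ 2 * y⁻¹)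
      = ∑ V : Fˣ, f (x ^ 3 * (V⁻¹) ^ 2) V := by
    refine Fintype.sum_equiv ((Equiv.inv Fˣ).trans (Equiv.mulLeft (x ^ 2))) _ _ fun y ↦ ?_
    congr 1
    ext
    simp
    field_simp
  simp_rw [h3]
  rw [sum_units_pow 3 (fun t ↦ ∑ V : Fˣ, f (t * (V⁻¹) ^ 2) V)]
  simp_rw [Finset.sum_mul]
  rw [Finset.sum_comm]
  refine Finset.sum_congr rfl fun χ hχ ↦ ?_
  have hχ3 : χ ^ 3 = 1 := by simpa using hχ
  trans ∑ V : Fˣ, ∑ U : Fˣ, χ (U * V⁻¹ : Fˣ) * f U V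
  swap
  · exact Finset.sum_comm
  simp_rw [Finset.mul_sum]
  rw [Finset.sum_comm]
  refine Finset.sum_congr rfl fun V _ ↦ ?_
  refine Fintype.sum_equiv (Equiv.mulRight (V⁻¹ ^ 2)) _ _ fun t ↦ ?_
  have hV : χ ((V ^ 3 : Fˣ) : F) = 1 := by
    rw [Units.val_pow_eq_pow_val, map_pow, ← MulChar.pow_apply_coe, hχ3, MulChar.one_apply_coe]
  have ht : χ t = χ (t * V⁻¹ ^ 2 * V⁻¹ : Fˣ) := by
    conv_lhs => rw [show t = (t * V⁻¹ ^ 2 * V⁻¹) * V ^ 3 by group, Units.val_mul, map_mul, hV,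
      mul_one]
  rw [ht]
  rfl

lemma card_compl_cubic_param {ζ : F} (hζ : ζ ^ 2 + ζ + 1 = 0) (h3 : (3 : F) ≠ 0) :
    #{ρ : F | ρ ≠ 0 ∧ 1 + ρ ≠ 0 ∧ ρ ^ 2 + ρ + 1 ≠ 0} + 4 = Fintype.card F := by
  have h : ({ρ : F | ρ ≠ 0 ∧ 1 + ρ ≠ 0 ∧ ρ ^ 2 + ρ + 1 ≠ 0} : Finset F)
      = ({0, -1, ζ, -1 - ζ} : Finset F)ᶜ := by
    ext ρ
    have e : ρ ^ 2 + ρ + 1 = (ρ - ζ) * (ρ - (-1 - ζ)) := by linear_combination hζ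
    have e' : 1 + ρ = 0 ↔ ρ = -1 := by rw [add_comm, add_eq_zero_iff_eq_neg]
    simp [e, e', sub_eq_zero]
  have h1 : (-1 : F) ≠ ζ := by rintro rfl; norm_num at hζ
  have h0 : (0 : F) ≠ ζ := by rintro rfl; norm_num at hζ
  have h2 : ζ ≠ -1 - ζ := by
    intro e
    apply h3
    linear_combination 4 * hζ - (2 * ζ + 1) * e
  have hc : #({0, -1, ζ, -1 - ζ} : Finset F) = 4 := by
    rw [card_insert_of_notMem, card_insert_of_notMem, card_pair h2]
    · simp only [mem_insert, mem_singleton, not_or]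
      exact ⟨h1, fun e ↦ h0 (by linear_combination -e)⟩
    · simp only [mem_insert, mem_singleton, not_or]
      exact ⟨by simp, h0, fun e ↦ h1 (by linear_combination -e)⟩
  rw [h, ← hc, card_compl_add_card]

lemma card_nodal_cubic {ζ : F} (hζ : ζ ^ 2 + ζ + 1 = 0) (h3 : (3 : F) ≠ 0) :
    #{P : Fˣ × Fˣ | (P.1 : F) + P.2 + (P.1 * P.2 : Fˣ)⁻¹ + -3 = 0} + 3 = Fintype.card F := by
  rw [← card_compl_cubic_param hζ h3, ← Finset.card_erase_add_one (a := ((1, 1) : Fˣ × Fˣ))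
    (by simp; norm_num)]
  suffices h : #(erase {P : Fˣ × Fˣ | (P.1 : F) + P.2 + (P.1 * P.2 : Fˣ)⁻¹ + -3 = 0} (1, 1)) =
      #{ρ : F | ρ ≠ 0 ∧ 1 + ρ ≠ 0 ∧ ρ ^ 2 + ρ + 1 ≠ 0} by rw [h]
  have key (P : Fˣ × Fˣ)
      (hP : P ∈ erase {P : Fˣ × Fˣ | (P.1 : F) + P.2 + (P.1 * P.2 : Fˣ)⁻¹ + -3 = 0} (1, 1)) :
      (P.2 : F) - 1 ≠ 0 ∧ (P.1 : F) ^ 2 * P.2 + P.1 * P.2 ^ 2 + 1 = 3 * (P.1 * P.2) := by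
    rw [mem_erase, mem_filter] at hP
    have h := cubic_eq_of_add_inv hP.2.2
    refine ⟨fun h2 ↦ hP.1 ?_, h⟩
    rw [sub_eq_zero] at h2
    rw [h2] at h
    have h1 : ((P.1 : F) - 1) ^ 2 = 0 := by linear_combination h
    have h1' : (P.1 : F) = 1 := by simpa [sub_eq_zero] using h1
    exact Prod.ext (Units.ext h1') (Units.ext h2)
  refine Finset.card_bij (fun P _ ↦ ((P.1 : F) - 1) / ((P.2 : F) - 1)) ?_ ?_ ?_
  · intro P hP
    obtain ⟨hV, hC⟩ := key P hP
    obtain ⟨e1, e2⟩ := nodal_cubic_param hV hC rfl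
    set ρ := ((P.1 : F) - 1) / ((P.2 : F) - 1)
    simp only [mem_filter, mem_univ, true_and]
    refine ⟨fun h ↦ ?_, fun h ↦ ?_, fun h ↦ hV ?_⟩
    · simp [h] at e1
    · simp [h] at e1
    · linear_combination -e1 + P.2 * h
  · intro P hP Q hQ h
    obtain ⟨hV, hC⟩ := key P hP
    obtain ⟨hV', hC'⟩ := key Q hQ
    obtain ⟨e1, e2⟩ := nodal_cubic_param hV hC rfl
    obtain ⟨e1', e2'⟩ := nodal_cubic_param hV' hC' rfl
    rw [← h] at e1' e2'
    set ρ := ((P.1 : F) - 1) / ((P.2 : F) - 1)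
    have h0 : ρ * (1 + ρ) ≠ 0 := by
      intro h0
      simp [h0] at e1
    have h2 : (P.2 : F) = Q.2 := mul_left_cancel₀ h0 (e1.trans e1'.symm)
    have h1 : (P.1 : F) = Q.1 := by rw [e2, e2', h2]
    exact Prod.ext (Units.ext h1) (Units.ext h2)
  · intro ρ hρ
    simp only [mem_filter, mem_univ, true_and] at hρ
    obtain ⟨h0, h1, h2⟩ := hρ
    have hV : (-1 / (ρ * (1 + ρ)) : F) ≠ 0 := by simp [h0, h1]
    have hU : (-ρ ^ 2 / (1 + ρ) : F) ≠ 0 := by simp [h0, h1]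
    have hV1 : (-1 / (ρ * (1 + ρ)) : F) - 1 = -(ρ ^ 2 + ρ + 1) / (ρ * (1 + ρ)) := by
      field_simp
      ring
    refine ⟨(Units.mk0 _ hU, Units.mk0 _ hV), ?_, ?_⟩
    · rw [mem_erase, mem_filter]
      refine ⟨fun h ↦ ?_, mem_univ _, ?_⟩
      · have h' : (-1 / (ρ * (1 + ρ)) : F) = 1 := congrArg (fun P : Fˣ × Fˣ ↦ (P.2 : F)) h
        rw [h', sub_self, eq_comm, div_eq_zero_iff, neg_eq_zero] at hV1
        simp [h0, h1, h2] at hV1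
      · simp only [Units.val_inv_eq_inv_val, Units.val_mul, Units.val_mk0]
        field_simp
        ring
    · simp only [Units.val_mk0]
      rw [hV1]
      have h2' : -(ρ ^ 2 + ρ + 1) ≠ 0 := neg_ne_zero.mpr h2
      rw [div_div_eq_mul_div, div_eq_iff h2']
      field_simp
      ring

lemma sum_nodal_cubic {ζ : F} (hζ : ζ ^ 2 + ζ + 1 = 0) (h3 : (3 : F) ≠ 0) {α : MulChar F ℂ}
    (hα : α ^ 3 = 1) :
    ∑ U : Fˣ, ∑ V : Fˣ, α (U * V⁻¹ : Fˣ) *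
      (if (U : F) + V + (U * V : Fˣ)⁻¹ + -3 = 0 then 1 else 0) = (Fintype.card F : ℂ) - 3 := by
  rw [← card_nodal_cubic hζ h3, ← Fintype.sum_prod_type' (f := fun U V : Fˣ ↦ α (U * V⁻¹ : Fˣ) *
      (if (U : F) + V + (U * V : Fˣ)⁻¹ + -3 = 0 then (1 : ℂ) else 0))]
  simp only [mul_ite, mul_one, mul_zero]
  rw [← Finset.sum_filter, Finset.sum_congr rfl (g := fun _ ↦ (1 : ℂ))]
  · simp
  intro P hP
  rw [mem_filter] at hP
  have hC := cubic_eq_of_add_inv hP.2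
  by_cases hV : (P.2 : F) - 1 = 0
  · rw [sub_eq_zero] at hV
    rw [hV] at hC
    have h1 : ((P.1 : F) - 1) ^ 2 = 0 := by linear_combination hC
    have h1' : (P.1 : F) = 1 := by simpa [sub_eq_zero] using h1
    simp [h1', hV]
  · obtain ⟨e1, e2⟩ := nodal_cubic_param hV hC rfl
    set ρ := ((P.1 : F) - 1) / ((P.2 : F) - 1)
    have h0 : ρ ≠ 0 := by
      intro h0
      simp [h0] at e1
    have : ((P.1 * P.2⁻¹ : Fˣ) : F) = (Units.mk0 ρ h0 : Fˣ) ^ 3 := by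
      simp [e2]
    rw [this, map_pow, ← MulChar.pow_apply_coe, hα, MulChar.one_apply_coe]

lemma norm_mulChar_unit (χ : MulChar F ℂ) (u : Fˣ) : ‖χ u‖ = 1 := by
  refine Complex.norm_eq_one_of_pow_eq_one (n := Fintype.card Fˣ) ?_ Fintype.card_ne_zero
  rw [← map_pow, ← Units.val_pow_eq_pow_val, pow_card_eq_one]
  simp

lemma norm_cubic_gaussSum_prod {ψ : AddChar F ℂ} (hψ : ψ ≠ 1) {ω χ : MulChar F ℂ}
    (hω3 : ω ^ 3 = 1) (hχ : χ ^ 3 ≠ 1) (c : Fˣ) :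
    ‖gaussSum (χ⁻¹ * ω) ψ * gaussSum (χ⁻¹ * ω⁻¹) ψ * gaussSum χ⁻¹ ψ * gaussSum (χ ^ 3) ψ
        * (χ ^ 3)⁻¹ c‖ = (Fintype.card F : ℝ) ^ 2 := by
  have h1 : χ⁻¹ * ω ≠ 1 := fun h ↦ hχ <| by
    rw [← inv_inj, ← inv_pow, eq_inv_of_mul_eq_one_left h, inv_pow, hω3]
  have h2 : χ⁻¹ * ω⁻¹ ≠ 1 := fun h ↦ hχ <| by
    rw [← inv_inj, ← inv_pow, eq_inv_of_mul_eq_one_left h, inv_inv, hω3, inv_one]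
  have h3 : χ⁻¹ ≠ 1 := fun h ↦ hχ <| by simp [inv_eq_one.mp h]
  have h : ∀ χ : MulChar F ℂ, χ ≠ 1 → ‖gaussSum χ ψ‖ = √(Fintype.card F) := fun χ hχ ↦ by
    rw [← norm_gaussSum_sq hχ hψ, Real.sqrt_sq (norm_nonneg _)]
  simp only [norm_mul, h _ h1, h _ h2, h _ h3, h _ hχ, norm_mulChar_unit]
  have := Real.mul_self_sqrt (Nat.cast_nonneg (α := ℝ) (Fintype.card F))
  rw [mul_one, this, mul_assoc, this, sq]

lemma sum_mulChar_mul_inv_eq_zero {α : MulChar F ℂ} (hα : α ≠ 1) :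
    ∑ U : Fˣ, ∑ V : Fˣ, α (U * V⁻¹ : Fˣ) = 0 := by
  refine Finset.sum_eq_zero fun U _ ↦ ?_
  rw [← sum_units_mulChar_eq_zero hα]
  exact Fintype.sum_equiv ((Equiv.inv Fˣ).trans (Equiv.mulLeft U)) _ _ fun V ↦ rfl

/-- An instance of the cubic Hasse–Davenport product formula, in disguise. -/
lemma cubic_gaussSum_prod_neg_three {ψ : AddChar F ℂ} (hψ : ψ ≠ 1) {ω : MulChar F ℂ}
    (hω1 : ω ≠ 1) (hω3 : ω ^ 3 = 1)
    (hω : ∀ χ : MulChar F ℂ, χ ^ 3 = 1 → χ = 1 ∨ χ = ω ∨ χ = ω⁻¹)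
    {ζ : F} (hζ : ζ ^ 2 + ζ + 1 = 0) {c : Fˣ} (hc : (c : F) = -3)
    {χ : MulChar F ℂ} (hχ : χ ^ 3 ≠ 1) :
    gaussSum (χ⁻¹ * ω) ψ * gaussSum (χ⁻¹ * ω⁻¹) ψ * gaussSum χ⁻¹ ψ * gaussSum (χ ^ 3) ψ
        * (χ ^ 3)⁻¹ c = (Fintype.card F : ℂ) ^ 2 := by
  classical
  have := Fintype.ofFinite (MulChar F ℂ)
  have h3 : (3 : F) ≠ 0 := by
    have := c.ne_zero
    rw [hc] at this
    simpa using this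
  have hsum := sum_gaussSum_prod_eq ψ ω c
  simp_rw [sum_units_addChar_mul hψ, hc, mul_sub, Finset.sum_sub_distrib, mul_one,
    sum_mulChar_mul_inv_eq_zero hω1, mul_left_comm _ (Fintype.card F : ℂ), ← Finset.mul_sum,
    sum_nodal_cubic hζ h3 hω3] at hsum
  rw [← hc, ← Finset.sum_filter_add_sum_filter_not univ (fun χ : MulChar F ℂ ↦ χ ^ 3 = 1),
    Finset.sum_congr rfl (g := fun _ ↦ (Fintype.card F : ℂ))
      (fun χ hχ ↦ cubic_gaussSum_prod_of_pow_eq_one hψ hω1 hω3 hω (by simpa using hχ) c),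
    Finset.sum_const, card_filter_cube_eq_one hω1 hω3 hω] at hsum
  have hcard : (#{χ : MulChar F ℂ | ¬ χ ^ 3 = 1} : ℂ) = (Fintype.card F : ℂ) - 4 := by
    have h := Finset.card_filter_add_card_filter_not (s := univ) (fun χ : MulChar F ℂ ↦ χ ^ 3 = 1)
    have h' := sum_mulChar_apply_unit (1 : Fˣ)
    rw [card_filter_cube_eq_one hω1 hω3 hω] at h
    simp only [Units.val_one, map_one, sum_const, nsmul_eq_mul, mul_one, ↓reduceIte] at h'
    rw [← h] at h'
    push_cast at h'
    linear_combination h'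
  have h := Complex.eq_of_sum_eq_card_mul
    (fun χ hχ ↦ norm_cubic_gaussSum_prod hψ hω3 (by simpa using hχ) c)
    (s := {χ : MulChar F ℂ | ¬ χ ^ 3 = 1}) (by
      rw [hcard]
      push_cast
      linear_combination hsum) χ (by simpa using hχ)
  exact_mod_cast h

lemma sum_cubic_gaussSum_prod [Fintype (MulChar F ℂ)] {ψ : AddChar F ℂ} (hψ : ψ ≠ 1)
    {ω : MulChar F ℂ} (hω1 : ω ≠ 1) (hω3 : ω ^ 3 = 1)
    (hω : ∀ χ : MulChar F ℂ, χ ^ 3 = 1 → χ = 1 ∨ χ = ω ∨ χ = ω⁻¹)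
    {ζ : F} (hζ : ζ ^ 2 + ζ + 1 = 0) {c a : Fˣ} (hc : (c : F) = -3) (ha : a ^ 3 ≠ 1) :
    ∑ χ : MulChar F ℂ, gaussSum (χ⁻¹ * ω) ψ * gaussSum (χ⁻¹ * ω⁻¹) ψ * gaussSum χ⁻¹ ψ *
        gaussSum (χ ^ 3) ψ * (χ ^ 3)⁻¹ (c * a : Fˣ)
      = -3 * Fintype.card F * ((Fintype.card F : ℂ) - 1) := by
  classical
  have h (χ : MulChar F ℂ) : gaussSum (χ⁻¹ * ω) ψ * gaussSum (χ⁻¹ * ω⁻¹) ψ * gaussSum χ⁻¹ ψ *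
        gaussSum (χ ^ 3) ψ * (χ ^ 3)⁻¹ (c * a : Fˣ)
      = (Fintype.card F : ℂ) ^ 2 * χ ((a ^ 3)⁻¹ : Fˣ) +
        if χ ^ 3 = 1 then (Fintype.card F : ℂ) - (Fintype.card F : ℂ) ^ 2 else 0 := by
    have e : (χ ^ 3)⁻¹ a = χ ((a ^ 3)⁻¹ : Fˣ) := by
      rw [MulChar.inv_apply', ← Units.val_inv_eq_inv_val, MulChar.pow_apply_coe, ← map_pow]
      simp
    split_ifs with hχ
    · rw [cubic_gaussSum_prod_of_pow_eq_one hψ hω1 hω3 hω hχ, ← e, hχ, inv_one,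
        MulChar.one_apply_coe]
      ring
    · rw [Units.val_mul, map_mul, ← mul_assoc,
        cubic_gaussSum_prod_neg_three hψ hω1 hω3 hω hζ hc hχ, e, add_zero]
  simp_rw [h, Finset.sum_add_distrib, ← Finset.mul_sum, sum_mulChar_apply_unit, inv_eq_one, if_neg ha,
    ← Finset.sum_filter, Finset.sum_const, card_filter_cube_eq_one hω1 hω3 hω]
  simp
  ring

lemma gaussSum_prod_mul_quadratic {ψ : AddChar F ℂ} (hψ : ψ ≠ 1) (χ : MulChar F ℂ)
    {φ : MulChar F ℂ} (h2 : (2 : F) ≠ 0) (hφ1 : φ ≠ 1)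
    (hφ2 : φ ^ 2 = 1) (hφ : ∀ χ : MulChar F ℂ, χ ^ 2 = 1 → χ = 1 ∨ χ = φ) (c : F) :
    gaussSum (χ * φ)⁻¹ ψ ^ 3 * gaussSum ((χ * φ) ^ 3) ψ * ((χ * φ) ^ 3)⁻¹ c
      = (Fintype.card F : ℂ) ^ 2 * φ c * (gaussSum (χ⁻¹ ^ 2) ψ ^ 3 * gaussSum (χ ^ 6) ψ /
          (gaussSum χ⁻¹ ψ ^ 3 * gaussSum (χ ^ 3) ψ) * (χ ^ 3)⁻¹ c) := by
  have hφi : φ⁻¹ = φ := inv_eq_of_mul_eq_one_left (by rw [← sq, hφ2])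
  have hφ3 : φ ^ 3 = φ := by rw [pow_succ, hφ2, one_mul]
  have e1 := gaussSum_mul_gaussSum_quadratic hψ χ⁻¹ h2 hφ1 hφ2 hφ
  have e2 := gaussSum_mul_gaussSum_quadratic hψ (χ ^ 3) h2 hφ1 hφ2 hφ
  rw [← pow_mul] at e2
  have h4 : (4 : F) ≠ 0 := by
    rw [show (4 : F) = 2 * 2 by norm_num]
    simp [h2]
  have e3 : χ⁻¹ 4 ^ 3 * (χ ^ 3) 4 = 1 := by
    rw [MulChar.pow_apply' _ three_ne_zero, MulChar.inv_apply', ← mul_pow, ← map_mul,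
      inv_mul_cancel₀ h4, map_one, one_pow]
  have n1 := gaussSum_ne_zero χ⁻¹ hψ
  have n2 := gaussSum_ne_zero (χ ^ 3) hψ
  have key : gaussSum (χ⁻¹ ^ 2) ψ ^ 3 * gaussSum (χ ^ 6) ψ * (Fintype.card F : ℂ) ^ 2
      = (gaussSum χ⁻¹ ψ ^ 3 * gaussSum (χ ^ 3) ψ) *
        (gaussSum (χ⁻¹ * φ) ψ ^ 3 * gaussSum (χ ^ 3 * φ) ψ) := by
    rw [← quadratic_gaussSum_pow_four hψ hφ1 hφ2]
    calc
      _ = (gaussSum (χ⁻¹ ^ 2) ψ * gaussSum φ ψ) ^ 3 * (gaussSum (χ ^ (3 * 2)) ψ * gaussSum φ ψ) := by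
        ring
      _ = (χ⁻¹ 4 ^ 3 * (χ ^ 3) 4) * ((gaussSum χ⁻¹ ψ ^ 3 * gaussSum (χ ^ 3) ψ) *
        (gaussSum (χ⁻¹ * φ) ψ ^ 3 * gaussSum (χ ^ 3 * φ) ψ)) := by
        rw [← e1, ← e2]; ring
      _ = _ := by rw [e3, one_mul]
  rw [mul_inv, mul_pow, mul_inv, hφ3, hφi, MulChar.mul_apply]
  field_simp
  linear_combination (-(χ ^ 3)⁻¹ c * φ c) * key

lemma sum_gaussSum_prod_quadratic [Fintype (MulChar F ℂ)] [DecidableEq (MulChar F ℂ)]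
    {ψ : AddChar F ℂ} (hψ : ψ ≠ 1)
    {φ : MulChar F ℂ} (h2 : (2 : F) ≠ 0) (hφ1 : φ ≠ 1)
    (hφ2 : φ ^ 2 = 1) (hφ : ∀ χ : MulChar F ℂ, χ ^ 2 = 1 → χ = 1 ∨ χ = φ) (c : Fˣ) :
    ∑ χ : MulChar F ℂ, gaussSum χ⁻¹ ψ ^ 3 * gaussSum (χ ^ 3) ψ * (χ ^ 3)⁻¹ c
      = (Fintype.card F : ℂ) ^ 2 * φ c *
        ∑ χ with χ ≠ φ, (gaussSum (χ⁻¹ ^ 2) ψ ^ 3 * gaussSum (χ ^ 6) ψ /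
          (gaussSum χ⁻¹ ψ ^ 3 * gaussSum (χ ^ 3) ψ) * (χ ^ 3)⁻¹ c) + 1 := by
  rw [← Equiv.sum_comp (Equiv.mulRight φ), ← Finset.sum_filter_add_sum_filter_not univ (· ≠ φ),
    Finset.mul_sum]
  congr 1
  · exact Finset.sum_congr rfl fun χ _ ↦ gaussSum_prod_mul_quadratic hψ χ h2 hφ1 hφ2 hφ c
  · simp only [ne_eq, not_not, Finset.filter_eq', mem_univ, if_true, sum_singleton,
      Equiv.coe_mulRight, ← sq φ, hφ2, inv_one, one_pow, MulChar.one_apply_coe,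
      gaussSum_one_left hψ]
    norm_num

end

/-- For `q ≡ 1 (mod 3)` and `a ∈ F_q^×` with `a³ ≠ 1`:
`Σ_{x,y,z ∈ F_q^×} ψ(z(1 + x³ + y³ − 3axy))
  = (q²·φ(−3a)/(q−1)) Σ_{l=0, l≠(q−1)/2}^{q−2} [G_{−2l}³ G_{6l} / (G_{−l}³ G_{3l})] T^{−3l}(−3a)
    + 1/(q−1) − 6q·φ(−3)`, where `φ = T^{(q−1)/2}` is the quadratic character. -/
theorem sum_hessian_char_eq_ratio_sum
    (p r : ℕ) (hp : p.Prime) (hp3 : 3 < p) (hr : 0 < r)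
    (F : Type) [Field F] [Fintype F] [DecidableEq F] (hcard : Fintype.card F = p ^ r)
    (ψ : AddChar F ℂ) (hψ : ψ ≠ 1)
    (T : MulChar F ℂ) (hT : ∀ χ : MulChar F ℂ, χ ∈ Subgroup.zpowers T)
    (hq3 : p ^ r % 3 = 1)
    (a : F) (ha : a ≠ 0) (ha3 : a ^ 3 ≠ 1) :
    (∑ x : Fˣ, ∑ y : Fˣ, ∑ z : Fˣ,
        ψ ((z : F) * (1 + (x : F) ^ 3 + (y : F) ^ 3 - 3 * a * (x : F) * (y : F))))
      = ((p : ℂ) ^ r) ^ 2 * (T ^ ((p ^ r - 1) / 2)) (-3 * a) / ((p : ℂ) ^ r - 1) *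
          (∑ l ∈ (Finset.range (p ^ r - 1)).filter (fun l => l ≠ (p ^ r - 1) / 2),
            ((gaussSum (T ^ (-(2 * (l : ℤ)))) ψ) ^ 3 * gaussSum (T ^ (6 * (l : ℤ))) ψ /
                ((gaussSum (T ^ (-(l : ℤ))) ψ) ^ 3 * gaussSum (T ^ (3 * (l : ℤ))) ψ)) *
              (T ^ (-(3 * (l : ℤ)))) (-3 * a))
        + 1 / ((p : ℂ) ^ r - 1)
        - 6 * (p : ℂ) ^ r * (T ^ ((p ^ r - 1) / 2)) (-3 : F) := by
  classical
  have := Fintype.ofFinite (MulChar F ℂ)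
  have hcop (n : ℕ) (hn : n.Prime) (hnp : n < p) : (n : F) ≠ 0 :=
    natCast_ne_zero_of_coprime_card (by
      rw [hcard]
      exact ((Nat.coprime_primes hn hp).mpr hnp.ne).pow_right r)
  have h2 : (2 : F) ≠ 0 := hcop 2 Nat.prime_two (by omega)
  have h3 : (3 : F) ≠ 0 := hcop 3 Nat.prime_three hp3
  have hodd : p ^ r % 2 = 1 :=
    Nat.odd_iff.mp ((hp.odd_of_ne_two (by omega)).pow)
  have hq1 : 1 < p ^ r := Nat.one_lt_pow hr.ne' hp.one_lt
  have hord : orderOf T = p ^ r - 1 := by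
    rw [orderOf_eq_card_of_forall_mem_zpowers hT,
      MulChar.card_eq_card_units_of_hasEnoughRootsOfUnity, Nat.card_eq_fintype_card,
      Fintype.card_units, hcard]
  have hqC : ((p : ℂ) ^ r) = (Fintype.card F : ℂ) := by rw [hcard]; push_cast; rfl
  have hq0 : (Fintype.card F : ℂ) - 1 ≠ 0 := by
    rw [sub_ne_zero]
    exact_mod_cast Fintype.one_lt_card.ne'
  rw [hqC, ← hord]
  set q : ℂ := (Fintype.card F : ℂ) with hq
  -- the quadratic character
  set φ := T ^ (orderOf T / 2) with hφdef
  have hn2 : orderOf T = orderOf T / 2 * 2 := by omega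
  have hφ1 : φ ≠ 1 := pow_ne_one_of_lt_orderOf (by omega) (by omega)
  have hφ2 : φ ^ 2 = 1 := by rw [hφdef, ← pow_mul, ← hn2, pow_orderOf_eq_one]
  have hφ : ∀ χ : MulChar F ℂ, χ ^ 2 = 1 → χ = 1 ∨ χ = φ :=
    fun χ ↦ eq_one_or_eq_of_sq_eq_one hT hn2
  -- a cubic character
  obtain ⟨ω, hω1, hω3, hω⟩ : ∃ ω : MulChar F ℂ, ω ≠ 1 ∧ ω ^ 3 = 1 ∧
      ∀ χ : MulChar F ℂ, χ ^ 3 = 1 → χ = 1 ∨ χ = ω ∨ χ = ω⁻¹ := by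
    have hn3 : orderOf T = orderOf T / 3 * 3 := by omega
    exact ⟨T ^ (orderOf T / 3), pow_ne_one_of_lt_orderOf (by omega) (by omega),
      by rw [← pow_mul, ← hn3, pow_orderOf_eq_one],
      fun χ ↦ eq_one_or_eq_or_eq_inv_of_cube_eq_one hT hn3⟩
  obtain ⟨ζ, hζ⟩ := exists_primitive_cube_root (F := F) (by rw [hcard]; exact hq3)
  have hφ3 : φ (-3) = 1 := by
    have h : (-3 : F) = (2 * ζ + 1) ^ 2 := by linear_combination -4 * hζ
    have h0 : 2 * ζ + 1 ≠ 0 := by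
      intro h0
      rw [h0] at h
      simp [h3] at h
    rw [h, show 2 * ζ + 1 = (Units.mk0 _ h0 : Fˣ) from rfl, map_pow, ← MulChar.pow_apply_coe, hφ2,
      MulChar.one_apply_coe]
  obtain ⟨c, hc⟩ : ∃ c : Fˣ, (c : F) = -3 := ⟨Units.mk0 (-3) (neg_ne_zero.mpr h3), rfl⟩
  obtain ⟨u, rfl⟩ : ∃ u : Fˣ, (u : F) = a := ⟨Units.mk0 a ha, rfl⟩
  have hu : u ^ 3 ≠ 1 := fun h ↦ ha3 (by rw [← Units.val_pow_eq_pow_val, h, Units.val_one])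
  have hd : (-3 * u : F) = (c * u : Fˣ) := by rw [Units.val_mul, hc]
  have hl : ∑ x : Fˣ, ∑ y : Fˣ, ∑ z : Fˣ,
        ψ ((z : F) * (1 + (x : F) ^ 3 + (y : F) ^ 3 - 3 * u * (x : F) * (y : F)))
      = ∑ x : Fˣ, ∑ y : Fˣ, ∑ z : Fˣ,
        ψ (z * (1 + (x : F) ^ 3 + (y : F) ^ 3 + (c * u : Fˣ) * x * y)) := by
    refine Finset.sum_congr rfl fun x _ ↦ Finset.sum_congr rfl fun y _ ↦
      Finset.sum_congr rfl fun z _ ↦ ?_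
    rw [← hd]
    congr 1
    ring
  have hB := sum_cubic_gaussSum_prod hψ hω1 hω3 hω hζ hc hu
  have hB' := sum_cubic_gaussSum_prod hψ (ω := ω⁻¹) (by simpa using hω1) (by simp [hω3])
    (fun χ hχ ↦ by rw [inv_inv, or_comm (a := χ = ω⁻¹)]; exact hω χ hχ) hζ hc hu
  have hA := sum_gaussSum_prod_quadratic hψ h2 hφ1 hφ2 hφ (c * u)
  have hA' := sum_gaussSum_prod_eq ψ 1 (c * u)
  rw [sum_gaussSum_prod_eq] at hB hB'
  have hr : ∑ l ∈ (Finset.range (orderOf T)).filter (fun l => l ≠ orderOf T / 2),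
            ((gaussSum (T ^ (-(2 * (l : ℤ)))) ψ) ^ 3 * gaussSum (T ^ (6 * (l : ℤ))) ψ /
                ((gaussSum (T ^ (-(l : ℤ))) ψ) ^ 3 * gaussSum (T ^ (3 * (l : ℤ))) ψ)) *
              (T ^ (-(3 * (l : ℤ)))) (-3 * u)
      = ∑ χ with χ ≠ φ, (gaussSum (χ⁻¹ ^ 2) ψ ^ 3 * gaussSum (χ ^ 6) ψ /
          (gaussSum χ⁻¹ ψ ^ 3 * gaussSum (χ ^ 3) ψ) * (χ ^ 3)⁻¹ (c * u : Fˣ)) := by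
    rw [← sum_range_eq_sum_ne hT (by omega)]
    refine Finset.sum_congr rfl fun l _ ↦ ?_
    rw [hd, show T ^ (-(2 * (l : ℤ))) = (T ^ l)⁻¹ ^ 2 by group,
      show T ^ (6 * (l : ℤ)) = (T ^ l) ^ 6 by group,
      show T ^ (-(l : ℤ)) = (T ^ l)⁻¹ by group,
      show T ^ (3 * (l : ℤ)) = (T ^ l) ^ 3 by group,
      show T ^ (-(3 * (l : ℤ))) = ((T ^ l) ^ 3)⁻¹ by group]
  have hA'' : ∑ χ : MulChar F ℂ, gaussSum χ⁻¹ ψ ^ 3 * gaussSum (χ ^ 3) ψ * (χ ^ 3)⁻¹ (c * u : Fˣ)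
      = ∑ χ : MulChar F ℂ, gaussSum (χ⁻¹ * 1) ψ * gaussSum (χ⁻¹ * 1⁻¹) ψ * gaussSum χ⁻¹ ψ *
        gaussSum (χ ^ 3) ψ * (χ ^ 3)⁻¹ (c * u : Fˣ) := by
    refine Finset.sum_congr rfl fun χ _ ↦ ?_
    rw [inv_one, mul_one]
    ring
  rw [hA''] at hA
  rw [hA] at hA'
  rw [hr, hl, sum_hessian_eq, filter_cube_eq_one hω3 hω, hφ3, hd,
    Finset.sum_insert (by simp [hω1.symm, eq_comm (a := (1 : MulChar F ℂ)), hω1]),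
    Finset.sum_pair (ne_inv_of_cube_eq_one hω1 hω3)]
  refine mul_left_cancel₀ hq0 ?_
  rw [mul_add, mul_add, hB, hB', ← hA']
  field_simp
  ring
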